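/- (Theorem: the summed cause-specific scoring rule is a proper scoring rule for the global CIF) Fix a time horizon ζ ∈ ℝ with G(ζ) > 0 and let ℓ : ℝ → Bool → ℝ be a proper binary scoring rule, i.e., for all q, p ∈ [0, 1]: q · ℓ(p, true) + (1 − q) · ℓ(p, false) ≤ q · ℓ(q, true) + (1 − q) · ℓ(q, false). For each k ∈ Fin K define L_{k,ζ}(p)(ω) = 1{T(ω) ≤ ζ ∧ Δ(ω) = k ∧ T(ω) < C(ω)} · ℓ(p, true) / G(T(ω)) + 1{T(ω) > ζ ∧ C(ω) > ζ} · ℓ(p, false) / G(ζ) + 1{T(ω) ≤ ζ ∧ Δ(ω) ≠ k ∧ T(ω) < C(ω)} · ℓ(p, false) / G(T(ω)). Then for every family of candidate values p : Fin K → [0, 1]: Σ_{k ∈ Fin K} ∫_Ω L_{k,ζ}(p_k) dℙ ≤ Σ_{k ∈ Fin K} ∫_Ω L_{k,ζ}(F_k(ζ)) dℙ. -/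

import Mathlib

open MeasureTheory ProbabilityTheory

/-- The pointwise IPCW-reweighted cause-specific score at horizon `ζ` for event
`k`, built from a binary scoring rule `ℓ` applied to the candidate value `p`. -/
noncomputable def causeScore {Ω : Type*} {K : ℕ}
    (T : Ω → ℝ) (Δ : Ω → Fin K) (C : Ω → ℝ) (G : ℝ → ℝ) (ζ : ℝ) (k : Fin K)
    (ℓ : ℝ → Bool → ℝ) (p : ℝ) (ω : Ω) : ℝ :=
  Set.indicator {ω' | T ω' ≤ ζ ∧ Δ ω' = k ∧ T ω' < C ω'}
      (fun ω' => ℓ p true / G (T ω')) ω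
  + Set.indicator {ω' | ζ < T ω' ∧ ζ < C ω'} (fun _ => ℓ p false / G ζ) ω
  + Set.indicator {ω' | T ω' ≤ ζ ∧ Δ ω' ≠ k ∧ T ω' < C ω'}
      (fun ω' => ℓ p false / G (T ω')) ω

theorem ipcw_aux {Ω α : Type*} [MeasurableSpace Ω] [MeasurableSpace α]
    (P : Measure Ω) [IsProbabilityMeasure P]
    (X : Ω → α) (C : Ω → ℝ) (hX : Measurable X) (hC : Measurable C)
    (hindep : IndepFun X C P)
    (G : ℝ → ℝ) (hG : ∀ t, G t = (P {ω | t < C ω}).toReal)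
    (ζ : ℝ) (hGζ : 0 < G ζ) (A : Set α) (hA : MeasurableSet A)
    (s : α → ℝ) (hs : Measurable s) (hsA : ∀ x ∈ A, s x ≤ ζ) (a : ℝ) :
    Integrable (Set.indicator {ω | X ω ∈ A ∧ s (X ω) < C ω} (fun ω => a / G (s (X ω)))) P ∧
    ∫ ω, Set.indicator {ω | X ω ∈ A ∧ s (X ω) < C ω} (fun ω => a / G (s (X ω))) ω ∂P
      = a * (P {ω | X ω ∈ A}).toReal := by
  have hanti : Antitone G := by
    intro t u htu
    rw [hG, hG]
    exact ENNReal.toReal_mono (measure_ne_top _ _)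
      (measure_mono fun ω (h : u < C ω) => lt_of_le_of_lt htu h)
  have hGm : Measurable G := hanti.measurable
  have hpm : P.map (fun ω => (X ω, C ω)) = (P.map X).prod (P.map C) :=
    (indepFun_iff_map_prod_eq_prod_map_map hX.aemeasurable hC.aemeasurable).1 hindep
  have : IsProbabilityMeasure (P.map X) := Measure.isProbabilityMeasure_map hX.aemeasurable
  have : IsProbabilityMeasure (P.map C) := Measure.isProbabilityMeasure_map hC.aemeasurable
  set B : Set (α × ℝ) := {z | z.1 ∈ A ∧ s z.1 < z.2} with hB
  have hBm : MeasurableSet B :=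
    (measurable_fst hA).inter (measurableSet_lt (hs.comp measurable_fst) measurable_snd)
  set g : α × ℝ → ℝ := B.indicator (fun z => a / G (s z.1)) with hg
  have hgm : Measurable g :=
    (measurable_const.div (hGm.comp (hs.comp measurable_fst))).indicator hBm
  have hbd : ∀ z, ‖g z‖ ≤ |a| / G ζ := by
    intro z
    by_cases hz : z ∈ B
    · rw [hg, Set.indicator_of_mem hz, Real.norm_eq_abs, abs_div]
      have h1 : G ζ ≤ G (s z.1) := hanti (hsA _ hz.1)
      rw [abs_of_pos (hGζ.trans_le h1)]
      gcongr
    · rw [hg, Set.indicator_of_notMem hz, norm_zero]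
      positivity
  have hgi : Integrable g ((P.map X).prod (P.map C)) :=
    Integrable.of_bound hgm.aestronglyMeasurable _ (Filter.Eventually.of_forall hbd)
  have hXC : Measurable (fun ω => (X ω, C ω)) := hX.prodMk hC
  have hcomp : Set.indicator {ω | X ω ∈ A ∧ s (X ω) < C ω} (fun ω => a / G (s (X ω)))
      = fun ω => g (X ω, C ω) := by
    funext ω
    simp [hg, hB, Set.indicator]
  rw [hcomp]
  refine ⟨?_, ?_⟩
  · rw [← hpm] at hgi
    exact hgi.comp_measurable hXC
  · rw [← integral_map (φ := fun ω => (X ω, C ω)) hXC.aemeasurable hgm.aestronglyMeasurable,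
      hpm, integral_prod _ hgi]
    have hin : ∀ x, ∫ c, g (x, c) ∂(P.map C) = A.indicator (fun _ => a) x := by
      intro x
      by_cases hx : x ∈ A
      · have : (fun c => g (x, c)) = (Set.Ioi (s x)).indicator (fun _ => a / G (s x)) := by
          funext c
          simp [hg, hB, Set.indicator, hx]
        rw [this, integral_indicator_const _ measurableSet_Ioi, Set.indicator_of_mem hx,
          measureReal_def, Measure.map_apply hC measurableSet_Ioi]
        have h2 : (P (C ⁻¹' Set.Ioi (s x))).toReal = G (s x) := (hG _).symm
        have h1 : 0 < G (s x) := hGζ.trans_le (hanti (hsA _ hx))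
        rw [h2, smul_eq_mul]
        field_simp
      · simp [hg, hB, hx, Set.indicator]
    simp_rw [hin]
    rw [integral_indicator_const _ hA, measureReal_def, Measure.map_apply hX hA, smul_eq_mul,
      mul_comm]
    rfl

theorem causeScore_integral
    {Ω : Type*} [MeasurableSpace Ω] (P : Measure Ω) [IsProbabilityMeasure P]
    {K : ℕ}
    (T : Ω → ℝ) (Δ : Ω → Fin K) (C : Ω → ℝ)
    (hT : Measurable T) (hΔ : Measurable Δ) (hC : Measurable C)
    (hindep : IndepFun (fun ω => (T ω, Δ ω)) C P)
    (G : ℝ → ℝ) (hG : ∀ t, G t = (P {ω | t < C ω}).toReal)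
    (ζ : ℝ) (hGζ : 0 < G ζ)
    (ℓ : ℝ → Bool → ℝ) (k : Fin K) (p : ℝ) :
    ∫ ω, causeScore T Δ C G ζ k ℓ p ω ∂P
      = (P {ω | T ω ≤ ζ ∧ Δ ω = k}).toReal * ℓ p true
        + (1 - (P {ω | T ω ≤ ζ ∧ Δ ω = k}).toReal) * ℓ p false := by
  have hX : Measurable (fun ω => (T ω, Δ ω)) := hT.prodMk hΔ
  have mT : MeasurableSet {z : ℝ × Fin K | z.1 ≤ ζ} := measurableSet_le measurable_fst measurable_const
  have mk : MeasurableSet {z : ℝ × Fin K | z.2 = k} := measurable_snd (measurableSet_singleton k)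
  obtain ⟨i1, e1⟩ := ipcw_aux P _ C hX hC hindep G hG ζ hGζ
    ({z | z.1 ≤ ζ} ∩ {z | z.2 = k}) (mT.inter mk) Prod.fst measurable_fst
    (fun x hx => hx.1) (ℓ p true)
  obtain ⟨i2, e2⟩ := ipcw_aux P _ C hX hC hindep G hG ζ hGζ
    ({z | z.1 ≤ ζ}ᶜ) mT.compl (fun _ => ζ) measurable_const
    (fun x hx => le_rfl) (ℓ p false)
  obtain ⟨i3, e3⟩ := ipcw_aux P _ C hX hC hindep G hG ζ hGζ
    ({z | z.1 ≤ ζ} ∩ {z | z.2 = k}ᶜ) (mT.inter mk.compl) Prod.fst measurable_fst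
    (fun x hx => hx.1) (ℓ p false)
  simp only [Set.mem_inter_iff, Set.mem_setOf_eq, Set.mem_compl_iff, not_le, and_assoc]
    at i1 e1 i2 e2 i3 e3
  unfold causeScore
  simp only [ne_eq]
  refine (integral_add (i1.add i2) i3).trans ?_
  rw [integral_add' i1 i2, e1, e2, e3]
  have m1 : MeasurableSet {ω | T ω ≤ ζ ∧ Δ ω = k} := hX (mT.inter mk)
  have m2 : MeasurableSet {ω | ζ < T ω} := measurableSet_lt measurable_const hT
  have hsum : (P {ω | ζ < T ω}).toReal + (P {ω | T ω ≤ ζ ∧ ¬ Δ ω = k}).toReal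
      = 1 - (P {ω | T ω ≤ ζ ∧ Δ ω = k}).toReal := by
    have h := probReal_compl_eq_one_sub (μ := P) m1
    have hU : {ω | T ω ≤ ζ ∧ Δ ω = k}ᶜ = {ω | T ω ≤ ζ ∧ ¬ Δ ω = k} ∪ {ω | ζ < T ω} := by
      ext ω
      simp only [Set.mem_compl_iff, Set.mem_setOf_eq, Set.mem_union, ← not_le]
      tauto
    rw [hU, measureReal_union _ m2] at h
    · simp only [measureReal_def] at h
      linarith
    · rw [Set.disjoint_left]
      intro ω h1 h2
      exact absurd h1.1 (not_le.2 h2)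
  rw [← hsum]
  ring

/-- (Theorem: the summed cause-specific scoring rule is a proper scoring rule
for the global CIF) If `ℓ` is a proper binary scoring rule, then for every
family of candidate values `p : Fin K → [0, 1]`, the sum over `k` of expected
reweighted cause-specific scores is at most that of the oracle family
`(F k ζ)_k`. -/
theorem summed_causeScore_proper
    {Ω : Type*} [MeasurableSpace Ω] (P : Measure Ω) [IsProbabilityMeasure P]
    {K : ℕ} (hK : 1 ≤ K)
    (T : Ω → ℝ) (Δ : Ω → Fin K) (C : Ω → ℝ)
    (hT : Measurable T) (hΔ : Measurable Δ) (hC : Measurable C)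
    (hindep : IndepFun (fun ω => (T ω, Δ ω)) C P)
    (G : ℝ → ℝ) (hG : ∀ t, G t = (P {ω | t < C ω}).toReal)
    (F : Fin K → ℝ → ℝ)
    (hF : ∀ k t, F k t = (P {ω | T ω ≤ t ∧ Δ ω = k}).toReal)
    (ζ : ℝ) (hGζ : 0 < G ζ)
    (ℓ : ℝ → Bool → ℝ)
    (hproper : ∀ q p : ℝ, q ∈ Set.Icc (0:ℝ) 1 → p ∈ Set.Icc (0:ℝ) 1 →
      q * ℓ p true + (1 - q) * ℓ p false ≤ q * ℓ q true + (1 - q) * ℓ q false)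
    (p : Fin K → ℝ) (hp : ∀ k, p k ∈ Set.Icc (0:ℝ) 1) :
    ∑ k : Fin K, ∫ ω, causeScore T Δ C G ζ k ℓ (p k) ω ∂P
      ≤ ∑ k : Fin K, ∫ ω, causeScore T Δ C G ζ k ℓ (F k ζ) ω ∂P := by
  refine Finset.sum_le_sum fun k _ => ?_
  rw [causeScore_integral P T Δ C hT hΔ hC hindep G hG ζ hGζ,
    causeScore_integral P T Δ C hT hΔ hC hindep G hG ζ hGζ, ← hF]
  refine hproper _ _ ?_ (hp k)
  rw [hF]
  exact ⟨ENNReal.toReal_nonneg, measureReal_le_one⟩
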